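/- Let n be even, let s ≠ t be pseudo-secondary structures on n positions with dg(s) ≥ dg(t), and let s', t' be pseudo-secondary structures on n+1 positions with s ≺ s', t ≺ t', |s'| = |s|, |t'| = |t|, and dg(s') < dg(t'). Then |s| = n/2, |t| = n/2 − 1, and dg(s) = dg(t) = n/2. -/

import Mathlib

/-- A pseudo-secondary structure on `n` positions: a partial matching on
`{1,…,n}`, i.e. a set of pairs `(i,j)` with `1 ≤ i < j ≤ n` in which no
position occurs in more than one pair (crossings allowed, θ = 0). -/
def IsPseudo (n : ℕ) (s : Finset (ℕ × ℕ)) : Prop :=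
  (∀ p ∈ s, 1 ≤ p.1 ∧ p.1 < p.2 ∧ p.2 ≤ n) ∧
  (∀ p ∈ s, ∀ q ∈ s, p ≠ q →
    p.1 ≠ q.1 ∧ p.1 ≠ q.2 ∧ p.2 ≠ q.1 ∧ p.2 ≠ q.2)

/-- `t` is obtained from `s` by adding or removing exactly one pair. -/
def Neighbor (s t : Finset (ℕ × ℕ)) : Prop :=
  (∃ p, p ∉ s ∧ t = insert p s) ∨ (∃ p, p ∈ s ∧ t = s.erase p)

/-- The degree `dg` of a pseudo-secondary structure `s` on `n` positions:
the number of pseudo-secondary structures on `n` positions obtainable from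
`s` by adding or removing exactly one pair. -/
noncomputable def dg (n : ℕ) (s : Finset (ℕ × ℕ)) : ℕ :=
  Set.ncard {t : Finset (ℕ × ℕ) | IsPseudo n t ∧ Neighbor s t}

/-- `s'` (on `n+1` positions) extends `s` (on `n` positions), written `s ≺ s'`:
either `s' = s` (position `n+1` unpaired), or `s' = s ∪ {(k, n+1)}` for some
position `k ∈ {1,…,n}` unpaired in `s`. -/
def ExtendsTo (n : ℕ) (s s' : Finset (ℕ × ℕ)) : Prop :=
  s' = s ∨ ∃ k, 1 ≤ k ∧ k ≤ n ∧ (∀ p ∈ s, p.1 ≠ k ∧ p.2 ≠ k) ∧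
    s' = insert (k, n + 1) s

def freePos (n : ℕ) (s : Finset (ℕ × ℕ)) : Finset ℕ :=
  Finset.Icc 1 n \ (s.image Prod.fst ∪ s.image Prod.snd)

lemma mem_freePos (n : ℕ) (s : Finset (ℕ × ℕ)) (k : ℕ) :
    k ∈ freePos n s ↔ (1 ≤ k ∧ k ≤ n) ∧ ∀ p ∈ s, p.1 ≠ k ∧ p.2 ≠ k := by
  simp only [freePos, Finset.mem_sdiff, Finset.mem_Icc, Finset.mem_union, Finset.mem_image, not_or,
    not_exists, not_and]
  constructor
  · rintro ⟨h, h1, h2⟩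
    exact ⟨h, fun p hp => ⟨h1 p hp, h2 p hp⟩⟩
  · rintro ⟨h, h1⟩
    exact ⟨h, fun p hp => (h1 p hp).1, fun p hp => (h1 p hp).2⟩

lemma card_freePos (n : ℕ) (s : Finset (ℕ × ℕ)) (hs : IsPseudo n s) :
    (freePos n s).card + 2 * s.card = n := by
  have hsub : s.image Prod.fst ∪ s.image Prod.snd ⊆ Finset.Icc 1 n := by
    intro k hk
    simp only [Finset.mem_union, Finset.mem_image] at hk
    rw [Finset.mem_Icc]
    rcases hk with ⟨p, hp, rfl⟩ | ⟨p, hp, rfl⟩ <;> have := hs.1 p hp <;> omega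
  have h1 : (s.image Prod.fst).card = s.card := by
    apply Finset.card_image_of_injOn
    intro p hp q hq h
    by_contra hne
    exact (hs.2 p hp q hq hne).1 h
  have h2 : (s.image Prod.snd).card = s.card := by
    apply Finset.card_image_of_injOn
    intro p hp q hq h
    by_contra hne
    exact (hs.2 p hp q hq hne).2.2.2 h
  have hd : Disjoint (s.image Prod.fst) (s.image Prod.snd) := by
    rw [Finset.disjoint_left]
    intro k hk hk'
    simp only [Finset.mem_image] at hk hk'
    obtain ⟨p, hp, rfl⟩ := hk
    obtain ⟨q, hq, h⟩ := hk'
    by_cases hne : p = q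
    · subst hne
      have := hs.1 p hp
      omega
    · exact (hs.2 p hp q hq hne).2.1 h.symm
  have h3 := Finset.card_sdiff_add_card_eq_card hsub
  rw [Finset.card_union_of_disjoint hd, h1, h2, Nat.card_Icc] at h3
  unfold freePos
  omega

def ltPairs (U : Finset ℕ) : Finset (ℕ × ℕ) := (U ×ˢ U).filter (fun p => p.1 < p.2)

lemma card_ltPairs (U : Finset ℕ) : 2 * (ltPairs U).card + U.card = U.card * U.card := by
  have h : U.offDiag = ltPairs U ∪ (ltPairs U).image Prod.swap := by
    ext ⟨a, b⟩
    simp only [ltPairs, Finset.mem_offDiag, Finset.mem_union, Finset.mem_image, Finset.mem_filter,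
      Finset.mem_product, Prod.exists, Prod.swap_prod_mk, Prod.mk.injEq]
    constructor
    · rintro ⟨ha, hb, hne⟩
      rcases lt_or_gt_of_ne hne with h | h
      · exact Or.inl ⟨⟨ha, hb⟩, h⟩
      · exact Or.inr ⟨b, a, ⟨⟨hb, ha⟩, h⟩, rfl, rfl⟩
    · rintro (⟨⟨ha, hb⟩, h⟩ | ⟨x, y, ⟨⟨ha, hb⟩, h⟩, rfl, rfl⟩)
      · exact ⟨ha, hb, h.ne⟩
      · exact ⟨hb, ha, h.ne'⟩
  have hd : Disjoint (ltPairs U) ((ltPairs U).image Prod.swap) := by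
    rw [Finset.disjoint_left]
    rintro ⟨a, b⟩ h1 h2
    simp only [ltPairs, Finset.mem_image, Finset.mem_filter,
      Finset.mem_product, Prod.exists, Prod.swap_prod_mk, Prod.mk.injEq] at h1 h2
    obtain ⟨x, y, ⟨_, h⟩, rfl, rfl⟩ := h2
    omega
  have hc := congrArg Finset.card h
  rw [Finset.card_union_of_disjoint hd, Finset.card_image_of_injective _ Prod.swap_injective,
    Finset.offDiag_card] at hc
  have : U.card ≤ U.card * U.card := Nat.le_mul_self _
  omega

lemma dg_eq (n : ℕ) (s : Finset (ℕ × ℕ)) (hs : IsPseudo n s) :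
    dg n s = (ltPairs (freePos n s)).card + s.card := by
  have hnot : ∀ p ∈ ltPairs (freePos n s), p ∉ s := by
    intro p hp hps
    simp only [ltPairs, Finset.mem_filter, Finset.mem_product, mem_freePos] at hp
    exact (hp.1.1.2 p hps).1 rfl
  have hset : {t : Finset (ℕ × ℕ) | IsPseudo n t ∧ Neighbor s t} =
      (((ltPairs (freePos n s)).image (fun p => insert p s) ∪ s.image (fun p => s.erase p) :
        Finset (Finset (ℕ × ℕ))) : Set (Finset (ℕ × ℕ))) := by
    ext t
    simp only [Set.mem_ofPred_eq, Finset.coe_union, Finset.coe_image, Set.mem_union, Set.mem_image,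
      Finset.mem_coe]
    constructor
    · rintro ⟨ht, ⟨p, hp, rfl⟩ | ⟨p, hp, rfl⟩⟩
      · refine Or.inl ⟨p, ?_, rfl⟩
        have hb := ht.1 p (Finset.mem_insert_self _ _)
        have hq : ∀ q ∈ s, _ := fun q hq => ht.2 q (Finset.mem_insert_of_mem hq) p
          (Finset.mem_insert_self _ _) (fun h => hp (h ▸ hq))
        simp only [ltPairs, Finset.mem_filter, Finset.mem_product, mem_freePos]
        refine ⟨⟨⟨by omega, fun q h => ?_⟩, ⟨by omega, fun q h => ?_⟩⟩, hb.2.1⟩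
        · exact ⟨(hq q h).1, (hq q h).2.2.1⟩
        · exact ⟨(hq q h).2.1, (hq q h).2.2.2⟩
      · exact Or.inr ⟨p, hp, rfl⟩
    · rintro (⟨p, hp, rfl⟩ | ⟨p, hp, rfl⟩)
      · refine ⟨?_, Or.inl ⟨p, hnot p hp, rfl⟩⟩
        simp only [ltPairs, Finset.mem_filter, Finset.mem_product, mem_freePos] at hp
        obtain ⟨⟨⟨h1, h2⟩, h3, h4⟩, h5⟩ := hp
        constructor
        · intro q hq
          rcases Finset.mem_insert.1 hq with rfl | hq
          · omega
          · exact hs.1 q hq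
        · intro q hq r hr hne
          rcases Finset.mem_insert.1 hq with rfl | hq1 <;>
            rcases Finset.mem_insert.1 hr with rfl | hr1
          · exact absurd rfl hne
          · have a := h2 r hr1
            have b := h4 r hr1
            exact ⟨a.1.symm, a.2.symm, b.1.symm, b.2.symm⟩
          · have a := h2 q hq1
            have b := h4 q hq1
            exact ⟨a.1, b.1, a.2, b.2⟩
          · exact hs.2 q hq1 r hr1 hne
      · refine ⟨⟨fun q hq => hs.1 q (Finset.mem_of_mem_erase hq), fun q hq r hr =>
          hs.2 q (Finset.mem_of_mem_erase hq) r (Finset.mem_of_mem_erase hr)⟩,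
          Or.inr ⟨p, hp, rfl⟩⟩
  unfold dg
  rw [hset, Set.ncard_coe_finset, Finset.card_union_of_disjoint, Finset.card_image_of_injOn,
    Finset.card_image_of_injOn]
  · intro p hp q hq h
    by_contra hne
    have : p ∈ s.erase q := Finset.mem_erase.2 ⟨hne, hp⟩
    have h' : s.erase p = s.erase q := h
    rw [← h'] at this
    exact Finset.notMem_erase p s this
  · intro p hp q hq h
    have h' : insert p s = insert q s := h
    have : p ∈ insert q s := h' ▸ Finset.mem_insert_self p s
    exact (Finset.mem_insert.1 this).resolve_right (hnot p hp)
  · rw [Finset.disjoint_left]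
    intro t h1 h2
    simp only [Finset.mem_image] at h1 h2
    obtain ⟨p, hp, rfl⟩ := h1
    obtain ⟨q, hq, h⟩ := h2
    have : p ∈ s.erase q := h ▸ Finset.mem_insert_self p s
    exact hnot p hp (Finset.mem_of_mem_erase this)

lemma ext_eq (n : ℕ) (s s' : Finset (ℕ × ℕ)) (hs : IsPseudo n s) (h : ExtendsTo n s s')
    (hc : s'.card = s.card) : s' = s := by
  rcases h with h | ⟨k, _, _, _, rfl⟩
  · exact h
  · rw [Finset.card_insert_of_notMem] at hc
    · omega
    · intro hk
      have := (hs.1 _ hk).2.2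
      simp at this

lemma dg_formula (n : ℕ) (s : Finset (ℕ × ℕ)) (hs : IsPseudo n s) :
    ∃ u, u + 2 * s.card = n ∧ 2 * dg n s + u = u * u + 2 * s.card :=
  ⟨_, card_freePos n s hs, by
    have := card_ltPairs (freePos n s)
    rw [dg_eq n s hs]
    omega⟩

theorem stmt_15 (n : ℕ) (hn : Even n) (s t s' t' : Finset (ℕ × ℕ))
    (hs : IsPseudo n s) (ht : IsPseudo n t) (hne : s ≠ t)
    (hst : dg n s ≥ dg n t)
    (hs' : IsPseudo (n + 1) s') (ht' : IsPseudo (n + 1) t')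
    (hes : ExtendsTo n s s') (het : ExtendsTo n t t')
    (hcs : s'.card = s.card) (hct : t'.card = t.card)
    (hlt : dg (n + 1) s' < dg (n + 1) t') :
    s.card = n / 2 ∧ t.card = n / 2 - 1 ∧ dg n s = n / 2 ∧ dg n t = n / 2 := by
  obtain rfl := ext_eq n s s' hs hes hcs
  obtain rfl := ext_eq n t t' ht het hct
  obtain ⟨u, hu, hdu⟩ := dg_formula n _ hs
  obtain ⟨v, hv, hdv⟩ := dg_formula n _ ht
  obtain ⟨u', hu', hdu'⟩ := dg_formula (n + 1) _ hs'
  obtain ⟨v', hv', hdv'⟩ := dg_formula (n + 1) _ ht'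
  obtain rfl : u' = u + 1 := by omega
  obtain rfl : v' = v + 1 := by omega
  have e1 : (u + 1) * (u + 1) = u * u + 2 * u + 1 := by ring
  have e2 : (v + 1) * (v + 1) = v * v + 2 * v + 1 := by ring
  rw [e1] at hdu'
  rw [e2] at hdv'
  obtain ⟨m, rfl⟩ := hn
  have huv : u < v := by omega
  obtain ⟨a, rfl⟩ : ∃ a, u = 2 * a := ⟨u / 2, by omega⟩
  obtain ⟨b, rfl⟩ : ∃ b, v = 2 * b := ⟨v / 2, by omega⟩
  have key : (2 * b) * (2 * b) + 4 * a ≤ (2 * a) * (2 * a) + 4 * b := by omega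
  have hab : a < b := by omega
  have hb : a + b ≤ 1 := by
    clear * - key hab
    obtain ⟨c, rfl⟩ : ∃ c, b = a + c + 1 := ⟨b - a - 1, by omega⟩
    by_contra hcon
    have h1 : 1 ≤ a + (a + c) := by omega
    nlinarith [Nat.mul_le_mul_left (c + 1) h1]
  obtain rfl : a = 0 := by omega
  obtain rfl : b = 1 := by omega
  omega
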